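/- Fix integers n ≥ 2 and 1 ≤ q ≤ n. There exist polynomials A, B ∈ ℚ[x] of degree at most 2q−3 (both zero when q = 1) and polynomials C, D ∈ ℚ[x] of degree at most 2n−2q−1 (both zero when q = n), depending only on n and q, such that for all integers r ≥ n+2 and 1 ≤ p ≤ r−n−1 one has p^{2q−2} + B(p) > 0, (r−p)^{2n−2q} + D(r−p) > 0, and (1/2) · Σ_I k_{p,q}(π(r,I)) = C(r−n,p) · μ_{q,n}(r,p) · ( (p^{2q−2} + A(p)) / (p^{2q−2} + B(p)) ) · ( ((r−p)^{2n−2q} + C(r−p)) / ((r−p)^{2n−2q} + D(r−p)) ), where the sum is over all (n−1)-element subsets I of [r] = {1,…,r}. -/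

import Mathlib

open MeasureTheory Filter

noncomputable section

/-- `σ_b(a)`: sum over all `b`-element subsets `J` of `{1,…,a}` of the product of elements. -/
def sigmaFn (b a : ℕ) : ℕ := ∑ J ∈ (Finset.Icc 1 a).powersetCard b, ∏ j ∈ J, j

/-- the `(α+1)`-st smallest element of a finite set of naturals (0-indexed). -/
def nthElt (I : Finset ℕ) (α : ℕ) : ℕ := (I.sort (· ≤ ·)).getD α 0

/-- the product `∏_{α=1}^{q−1} (p+q−i_α)_+ · ∏_{α=q}^{n−1} (i_α−p−q)_+`. -/
def pureNum (n p q : ℕ) (I : Finset ℕ) : ℤ :=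
  ∏ α ∈ Finset.range (n - 1),
    if α + 1 < q then max ((p : ℤ) + q - nthElt I α) 0
    else max ((nthElt I α : ℤ) - p - q) 0

/-- the entry `k_{p,q}(π(r,I))` of the pure diagram `π(r,I)`. -/
def kPure (n r p q : ℕ) (I : Finset ℕ) : ℝ :=
  ((r - n).factorial : ℝ) * (pureNum n p q I : ℝ) /
    (((p + q - 1).factorial : ℝ) * ((r - p - q).factorial : ℝ))

/-- `μ_{q,n}(r,p)`. -/
def muFn (n q r p : ℕ) : ℝ :=
  (1 / 2 ^ n) * ((p : ℝ) ^ (q - 1) * ((r : ℝ) - p - n) ^ (n - q)) /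
    ((q - 1).factorial * (n - q).factorial)

open Polynomial in
theorem antidiff (d : ℕ) : ∀ f : ℝ[X], f.natDegree ≤ d → ∃ F : ℝ[X], F.natDegree ≤ d + 1 ∧
    F.coeff (d+1) * (d+1) = f.coeff d ∧ F.eval 0 = 0 ∧
    ∀ a : ℕ, F.eval ((a:ℝ)+1) = F.eval (a:ℝ) + f.eval (a:ℝ) := by
  induction d with
  | zero =>
    intro f hf
    rw [Polynomial.eq_C_of_natDegree_le_zero hf]
    refine ⟨C (f.coeff 0) * X, ?_, ?_, ?_, ?_⟩
    · exact (natDegree_C_mul_le _ _).trans (by simp)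
    · simp
    · simp
    · intro a; simp; ring
  | succ d ih =>
    intro f hf
    set c : ℝ := f.coeff (d+1) / (d+2) with hc
    set G : ℝ[X] := C c * ((X + 1) ^ (d+2) - X ^ (d+2)) with hG
    have hd2 : ((d:ℝ)+2) ≠ 0 := by positivity
    have hcoef : ∀ k, G.coeff k = c * (((d+2).choose k : ℝ) - if k = d+2 then 1 else 0) := by
      intro k
      simp [hG, coeff_X_add_one_pow, coeff_X_pow]
    have hfG : (f - G).natDegree ≤ d := by
      rw [natDegree_le_iff_coeff_eq_zero]
      intro N hN
      rw [coeff_sub, hcoef]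
      rcases eq_or_lt_of_le (Nat.succ_le_of_lt hN) with h | h
      · subst h
        have : ((d+2).choose (d+1) : ℝ) = d + 2 := by
          rw [show d + 2 = (d+1)+1 from rfl, Nat.choose_succ_self_right]; push_cast; ring
        simp only [Nat.succ_eq_add_one, this]
        simp [hc]
        field_simp
        simp
      · have h1 : f.coeff N = 0 := coeff_eq_zero_of_natDegree_lt (by omega)
        rw [h1]
        rcases eq_or_ne N (d+2) with h2 | h2
        · subst h2; simp
        · rw [Nat.choose_eq_zero_of_lt (by omega)]; simp [h2]
    obtain ⟨F, h1, h2, h3, h4⟩ := ih _ hfG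
    refine ⟨F + C c * X ^ (d+2), ?_, ?_, ?_, ?_⟩
    · refine natDegree_add_le_of_degree_le (by omega) (natDegree_C_mul_X_pow_le _ _)
    · have : F.coeff (d+1+1) = 0 := coeff_eq_zero_of_natDegree_lt (by omega)
      simp [this, hc]
      field_simp
      ring
    · simp [h3]
    · intro a
      have := h4 a
      simp only [eval_add, eval_mul, eval_C, eval_pow, eval_X, this, eval_sub, hG, eval_one]
      ring

theorem sigma_rec (b a : ℕ) : sigmaFn (b+1) (a+1) = sigmaFn (b+1) a + (a+1) * sigmaFn b a := by
  unfold sigmaFn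
  have hI : Finset.Icc 1 (a+1) = insert (a+1) (Finset.Icc 1 a) := by
    ext x; simp; omega
  have hn : a + 1 ∉ Finset.Icc 1 a := by simp
  rw [hI, Finset.powersetCard_succ_insert hn, Finset.sum_union, Finset.sum_image, Finset.mul_sum]
  · congr 1
    refine Finset.sum_congr rfl fun J hJ => ?_
    rw [Finset.prod_insert]
    intro h
    exact hn ((Finset.mem_powersetCard.1 hJ).1 h)
  · intro J hJ K hK h
    have h1 : a + 1 ∉ J := fun h => hn ((Finset.mem_powersetCard.1 hJ).1 h)
    have h2 : a + 1 ∉ K := fun h => hn ((Finset.mem_powersetCard.1 hK).1 h)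
    rw [← Finset.erase_insert h1, ← Finset.erase_insert h2]
    exact congrArg (fun s => Finset.erase s (a+1)) h
  · rw [Finset.disjoint_left]
    intro J hJ hJ'
    obtain ⟨K, -, rfl⟩ := Finset.mem_image.1 hJ'
    exact hn ((Finset.mem_powersetCard.1 hJ).1 (Finset.mem_insert_self _ _))

open Polynomial in
theorem sigma_poly (b : ℕ) : ∃ S : ℝ[X], S.Monic ∧ S.natDegree = 2 * b ∧
    ∀ a : ℕ, S.eval (a:ℝ) = 2 ^ b * b.factorial * sigmaFn b a := by
  induction b with
  | zero => exact ⟨1, monic_one, by simp, fun a => by simp [sigmaFn]⟩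
  | succ b ih =>
    obtain ⟨S, hm, hd, hS⟩ := ih
    have hm' : ((X + C 1) * S).Monic := (monic_X_add_C 1).mul hm
    have hd' : ((X + C (1:ℝ)) * S).natDegree = 2 * b + 1 := by
      rw [(monic_X_add_C 1).natDegree_mul hm, natDegree_X_add_C, hd]; ring
    have hco : ((X + C (1:ℝ)) * S).coeff (2*b+1) = 1 := by
      rw [← hd']; exact hm'
    obtain ⟨F, h1, h2, h3, h4⟩ := antidiff (2*b+1) (C (2*(b+1) : ℝ) * ((X + C 1) * S))
      ((natDegree_C_mul_le _ _).trans hd'.le)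
    have hb : (2*(b:ℝ)+1+1) ≠ 0 := by positivity
    have hF : F.coeff (2*b+1+1) = 1 := by
      rw [coeff_C_mul, hco] at h2
      push_cast at h2
      apply mul_right_cancel₀ hb
      rw [h2]; ring
    refine ⟨F, monic_of_natDegree_le_of_coeff_eq_one _ h1 hF, ?_, ?_⟩
    · apply le_antisymm (by omega)
      apply le_natDegree_of_ne_zero
      rw [show 2 * (b+1) = 2*b+1+1 by ring, hF]; exact one_ne_zero
    · intro a
      induction a with
      | zero =>
        have : Finset.powersetCard (b+1) (∅ : Finset ℕ) = ∅ :=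
          Finset.powersetCard_eq_empty.2 (by simp)
        simp [h3, sigmaFn, this]
      | succ a iha =>
        rw [sigma_rec]
        push_cast
        rw [h4, iha]
        simp only [eval_mul, eval_C, eval_add, eval_X, hS, Nat.factorial_succ]
        push_cast
        ring

theorem prod_getD (f : ℕ → ℤ) (L : List ℕ) :
    ∏ α ∈ Finset.range L.length, f (L.getD α 0) = (L.map f).prod := by
  induction L with
  | nil => simp
  | cons x L ih =>
    rw [List.length_cons, Finset.prod_range_succ']
    simp only [List.getD_cons_succ, List.getD_cons_zero, ih, List.map_cons, List.prod_cons]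
    ring

theorem prod_sort (f : ℕ → ℤ) (J : Finset ℕ) :
    ((J.sort (· ≤ ·)).map f).prod = ∏ j ∈ J, f j := by
  rw [Finset.prod, ← Finset.sort_eq J (· ≤ ·), Multiset.map_coe, Multiset.prod_coe]

theorem sort_union (J K : Finset ℕ) (h : ∀ j ∈ J, ∀ k ∈ K, j < k) :
    (J ∪ K).sort (· ≤ ·) = J.sort (· ≤ ·) ++ K.sort (· ≤ ·) := by
  have hd : Disjoint J K := by
    rw [Finset.disjoint_left]
    intro j hj hk
    exact lt_irrefl _ (h j hj j hk)
  apply List.Perm.eq_of_pairwise' (r := (· ≤ ·))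
  · exact Finset.pairwise_sort _ _
  · rw [List.pairwise_append]
    refine ⟨Finset.pairwise_sort _ _, Finset.pairwise_sort _ _, ?_⟩
    intro a ha b hb
    exact (h a ((Finset.mem_sort _).1 ha) b ((Finset.mem_sort _).1 hb)).le
  · rw [← Multiset.coe_eq_coe, ← Multiset.coe_add, Finset.sort_eq, Finset.sort_eq, Finset.sort_eq,
      ← Finset.disjUnion_eq_union _ _ hd]
    rfl

theorem pureNum_union (n p q : ℕ) (hq1 : 1 ≤ q) (hqn : q ≤ n) (J K : Finset ℕ)
    (hJ : J.card = q - 1) (hK : K.card = n - q)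
    (hJm : ∀ j ∈ J, j < p + q) (hKm : ∀ k ∈ K, p + q < k) :
    pureNum n p q (J ∪ K) = (∏ j ∈ J, ((p:ℤ) + q - j)) * ∏ k ∈ K, ((k:ℤ) - p - q) := by
  unfold pureNum nthElt
  rw [sort_union J K (fun j hj k hk => (hJm j hj).trans (hKm k hk)),
    show n - 1 = (q - 1) + (n - q) by omega, Finset.prod_range_add]
  congr 1
  · rw [← prod_sort _ J, ← prod_getD, Finset.length_sort, hJ]
    refine Finset.prod_congr rfl fun α hα => ?_
    have hα' := Finset.mem_range.1 hα
    have hl : α < (J.sort (· ≤ ·)).length := by rw [Finset.length_sort, hJ]; exact hα'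
    rw [if_pos (by omega), List.getD_append _ _ _ _ hl]
    apply max_eq_left
    rw [List.getD_eq_getElem _ _ hl]
    have := hJm _ ((Finset.mem_sort (· ≤ ·)).1 (List.getElem_mem hl))
    omega
  · rw [← prod_sort _ K, ← prod_getD, Finset.length_sort, hK]
    refine Finset.prod_congr rfl fun α hα => ?_
    have hα' := Finset.mem_range.1 hα
    have hl : α < (K.sort (· ≤ ·)).length := by rw [Finset.length_sort, hK]; exact hα'
    rw [if_neg (by omega), List.getD_append_right _ _ _ _ (by rw [Finset.length_sort, hJ]; omega),
      Finset.length_sort, hJ, Nat.add_sub_cancel_left]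
    apply max_eq_left
    rw [List.getD_eq_getElem _ _ hl]
    have := hKm _ ((Finset.mem_sort (· ≤ ·)).1 (List.getElem_mem hl))
    omega

theorem pureNum_ne_zero (n p q : ℕ) (hq1 : 1 ≤ q) (hqn : q ≤ n) (I : Finset ℕ)
    (hI : I.card = n - 1) (h : pureNum n p q I ≠ 0) :
    (I.filter (· < p + q)).card = q - 1 ∧ (I.filter (p + q < ·)).card = n - q ∧
      I.filter (· < p + q) ∪ I.filter (p + q < ·) = I := by
  have hlen : (I.sort (· ≤ ·)).length = n - 1 := by rw [Finset.length_sort, hI]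
  have hne := Finset.prod_ne_zero_iff.1 h
  have hmem : ∀ α < n - 1, nthElt I α ∈ I := by
    intro α hα
    unfold nthElt
    rw [List.getD_eq_getElem _ _ (by omega)]
    exact (Finset.mem_sort (· ≤ ·)).1 (List.getElem_mem _)
  have hinj : ∀ α < n - 1, ∀ β < n - 1, nthElt I α = nthElt I β → α = β := by
    intro α hα β hβ hab
    unfold nthElt at hab
    rw [List.getD_eq_getElem _ _ (by omega), List.getD_eq_getElem _ _ (by omega)] at hab
    exact (Finset.sort_nodup I (· ≤ ·)).getElem_inj_iff.1 hab
  have hA : q - 1 ≤ (I.filter (· < p + q)).card := by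
    rw [← Finset.card_range (q - 1)]
    refine Finset.card_le_card_of_injOn (nthElt I) ?_ ?_
    · intro α hα
      have hα' : α < q - 1 := by simpa using hα
      have := hne α (Finset.mem_range.2 (by omega))
      rw [if_pos (by omega)] at this
      simp only [Finset.coe_filter, Set.mem_ofPred_eq]
      exact ⟨hmem α (by omega), by omega⟩
    · intro α hα β hβ
      have hα' : α < q - 1 := by simpa using hα
      have hβ' : β < q - 1 := by simpa using hβ
      exact hinj α (by omega) β (by omega)
  have hB : n - q ≤ (I.filter (p + q < ·)).card := by
    rw [← Finset.card_range (n - q)]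
    refine Finset.card_le_card_of_injOn (fun α => nthElt I (q - 1 + α)) ?_ ?_
    · intro α hα
      have hα' : α < n - q := by simpa using hα
      have := hne (q - 1 + α) (Finset.mem_range.2 (by omega))
      rw [if_neg (by omega)] at this
      simp only [Finset.coe_filter, Set.mem_ofPred_eq]
      exact ⟨hmem _ (by omega), by omega⟩
    · intro α hα β hβ hab
      have hα' : α < n - q := by simpa using hα
      have hβ' : β < n - q := by simpa using hβ
      have := hinj (q - 1 + α) (by omega) (q - 1 + β) (by omega) hab
      omega
  have hd : Disjoint (I.filter (· < p + q)) (I.filter (p + q < ·)) := by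
    rw [Finset.disjoint_left]
    intro x hx hx'
    have h1 := (Finset.mem_filter.1 hx).2
    have h2 := (Finset.mem_filter.1 hx').2
    omega
  have hsub : I.filter (· < p + q) ∪ I.filter (p + q < ·) ⊆ I :=
    Finset.union_subset (Finset.filter_subset _ _) (Finset.filter_subset _ _)
  have hc := Finset.card_le_card hsub
  rw [Finset.card_union_of_disjoint hd] at hc
  refine ⟨by omega, by omega, Finset.eq_of_subset_of_card_le hsub ?_⟩
  rw [Finset.card_union_of_disjoint hd]
  omega

theorem sigma_esymm (b a : ℕ) (s : Finset ℕ) (f : ℕ → ℤ)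
    (h : s.val.map f = (Finset.Icc 1 a).val.map (Nat.cast : ℕ → ℤ)) :
    ∑ J ∈ s.powersetCard b, ∏ j ∈ J, f j = sigmaFn b a := by
  rw [← Finset.esymm_map_val, h, Finset.esymm_map_val]
  simp [sigmaFn]

theorem map_val_eq (a : ℕ) (s : Finset ℕ) (f : ℕ → ℤ) (g : ℕ → ℕ)
    (hg : ∀ x ∈ s, f x = g x) (hinj : ∀ x ∈ s, ∀ y ∈ s, g x = g y → x = y)
    (him : s.image g = Finset.Icc 1 a) :
    s.val.map f = (Finset.Icc 1 a).val.map (Nat.cast : ℕ → ℤ) := by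
  rw [← him, Finset.image_val_of_injOn (fun x hx y hy => hinj x hx y hy), Multiset.map_map]
  exact Multiset.map_congr rfl hg

theorem sum_pureNum (n r p q : ℕ) (hq1 : 1 ≤ q) (hqn : q ≤ n) (hr : p + q ≤ r) :
    ∑ I ∈ (Finset.Icc 1 r).powersetCard (n - 1), pureNum n p q I =
      (sigmaFn (q - 1) (p + q - 1) : ℤ) * sigmaFn (n - q) (r - p - q) := by
  have e1 := sigma_esymm (q - 1) (p + q - 1) (Finset.Icc 1 (p + q - 1))
    (fun j => (p:ℤ) + q - j) (map_val_eq _ _ _ (fun j => p + q - j)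
      (by intro x hx; rw [Finset.mem_Icc] at hx; push_cast [show x ≤ p + q by omega]; rfl)
      (by intro x hx y hy hxy; rw [Finset.mem_Icc] at hx hy; omega)
      (by
        ext y
        simp only [Finset.mem_image, Finset.mem_Icc]
        constructor
        · rintro ⟨x, hx, rfl⟩; omega
        · intro hy; exact ⟨p + q - y, by omega, by omega⟩))
  have e2 := sigma_esymm (n - q) (r - p - q) (Finset.Icc (p + q + 1) r)
    (fun j => (j:ℤ) - p - q) (map_val_eq _ _ _ (fun j => j - (p + q))
      (by intro x hx; rw [Finset.mem_Icc] at hx; push_cast [show p + q ≤ x by omega]; ring)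
      (by intro x hx y hy hxy; rw [Finset.mem_Icc] at hx hy; omega)
      (by
        ext y
        simp only [Finset.mem_image, Finset.mem_Icc]
        constructor
        · rintro ⟨x, hx, rfl⟩; omega
        · intro hy; exact ⟨p + q + y, by omega, by omega⟩))
  rw [← e1, ← e2, Finset.sum_mul_sum, ← Finset.sum_product']
  symm
  refine Finset.sum_bij_ne_zero (fun x _ _ => x.1 ∪ x.2) ?_ ?_ ?_ ?_
  · rintro ⟨J, K⟩ hJK -
    rw [Finset.mem_product, Finset.mem_powersetCard, Finset.mem_powersetCard] at hJK
    obtain ⟨⟨hJ, hJc⟩, ⟨hK, hKc⟩⟩ := hJK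
    dsimp only at *
    rw [Finset.mem_powersetCard]
    refine ⟨?_, ?_⟩
    · intro x hx
      rw [Finset.mem_Icc]
      rcases Finset.mem_union.1 hx with h | h
      · have := Finset.mem_Icc.1 (hJ h); omega
      · have := Finset.mem_Icc.1 (hK h); omega
    · rw [Finset.card_union_of_disjoint, hJc, hKc]
      · omega
      · rw [Finset.disjoint_left]
        intro x h h'
        have := Finset.mem_Icc.1 (hJ h)
        have := Finset.mem_Icc.1 (hK h')
        omega
  · rintro ⟨J, K⟩ hJK - ⟨J', K'⟩ hJK' - heq
    rw [Finset.mem_product, Finset.mem_powersetCard, Finset.mem_powersetCard] at hJK hJK'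
    obtain ⟨⟨hJ, hJc⟩, ⟨hK, hKc⟩⟩ := hJK
    obtain ⟨⟨hJ', hJc'⟩, ⟨hK', hKc'⟩⟩ := hJK'
    dsimp only at *
    have key : ∀ x, (x ∈ J ∨ x ∈ K) ↔ (x ∈ J' ∨ x ∈ K') := by
      intro x
      rw [← Finset.mem_union, ← Finset.mem_union, heq]
    have a1 : ∀ x ∈ J, x < p + q := fun x h => by have := Finset.mem_Icc.1 (hJ h); omega
    have a2 : ∀ x ∈ J', x < p + q := fun x h => by have := Finset.mem_Icc.1 (hJ' h); omega
    have a3 : ∀ x ∈ K, p + q < x := fun x h => by have := Finset.mem_Icc.1 (hK h); omega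
    have a4 : ∀ x ∈ K', p + q < x := fun x h => by have := Finset.mem_Icc.1 (hK' h); omega
    have b1 : J = J' := by
      ext x
      have := key x; have := a1 x; have := a2 x; have := a3 x; have := a4 x
      grind
    have b2 : K = K' := by
      ext x
      have := key x; have := a1 x; have := a2 x; have := a3 x; have := a4 x
      grind
    rw [b1, b2]
  · intro I hI hne
    obtain ⟨hIs, hIc⟩ := Finset.mem_powersetCard.1 hI
    obtain ⟨h1, h2, h3⟩ := pureNum_ne_zero n p q hq1 hqn I hIc hne
    refine ⟨(I.filter (· < p + q), I.filter (p + q < ·)), ?_, ?_, h3⟩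
    · rw [Finset.mem_product, Finset.mem_powersetCard, Finset.mem_powersetCard]
      refine ⟨⟨?_, h1⟩, ⟨?_, h2⟩⟩
      · intro x hx
        obtain ⟨hx1, hx2⟩ := Finset.mem_filter.1 hx
        have := Finset.mem_Icc.1 (hIs hx1)
        exact Finset.mem_Icc.2 (by omega)
      · intro x hx
        obtain ⟨hx1, hx2⟩ := Finset.mem_filter.1 hx
        have := Finset.mem_Icc.1 (hIs hx1)
        exact Finset.mem_Icc.2 (by omega)
    · rw [← pureNum_union n p q hq1 hqn _ _ h1 h2 (fun j hj => (Finset.mem_filter.1 hj).2)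
        (fun j hj => (Finset.mem_filter.1 hj).2), h3]
      exact hne
  · rintro ⟨J, K⟩ hJK -
    rw [Finset.mem_product, Finset.mem_powersetCard, Finset.mem_powersetCard] at hJK
    obtain ⟨⟨hJ, hJc⟩, ⟨hK, hKc⟩⟩ := hJK
    symm
    refine pureNum_union n p q hq1 hqn J K hJc hKc ?_ ?_
    · intro x h
      have := Finset.mem_Icc.1 (hJ h); omega
    · intro x h
      have := Finset.mem_Icc.1 (hK h); omega

open Polynomial in
/-- a monic polynomial of degree `2b` is `X^{2b}` plus lower-order terms. -/
theorem monic_tail (b : ℕ) (S : ℝ[X]) (hm : S.Monic) (hd : S.natDegree = 2 * b) :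
    (S - X ^ (2 * b)).degree ≤ ((2 * b - 1 : ℕ) : WithBot ℕ) ∧ (b = 0 → S - X ^ (2 * b) = 0) := by
  have h0 : b = 0 → S - X ^ (2 * b) = 0 := by
    rintro rfl
    rw [hm.natDegree_eq_zero.1 (by simpa using hd)]; simp
  refine ⟨?_, h0⟩
  rcases Nat.eq_zero_or_pos b with h | h
  · rw [h0 h]; simp
  · rw [degree_le_iff_coeff_zero]
    intro N hN
    have hN' : 2 * b - 1 < N := by exact_mod_cast hN
    rw [coeff_sub, coeff_X_pow]
    split_ifs with hNb
    · rw [hNb, ← hd, hm.coeff_natDegree, sub_self]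
    · rw [coeff_eq_zero_of_natDegree_lt (by omega), sub_self]

open Polynomial in
/-- the denominators: `(X - t)^b * ∏_{j<b} (X + u - j)`. -/
theorem den_poly (b : ℕ) (t u : ℝ) : ∃ T : ℝ[X], T.Monic ∧ T.natDegree = 2 * b ∧
    ∀ x : ℝ, T.eval x = (x - t) ^ b * ∏ j ∈ Finset.range b, (x + u - j) := by
  have hP : (∏ j ∈ Finset.range b, (X + C (u - j) : ℝ[X])).Monic :=
    monic_prod_of_monic _ _ fun j _ => monic_X_add_C _
  have hQ : ((X - C t) ^ b : ℝ[X]).Monic := (monic_X_sub_C t).pow b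
  refine ⟨(X - C t) ^ b * ∏ j ∈ Finset.range b, (X + C (u - j)), hQ.mul hP, ?_, ?_⟩
  · rw [hQ.natDegree_mul hP, (monic_X_sub_C t).natDegree_pow,
      natDegree_prod_of_monic _ _ fun j _ => monic_X_add_C _]
    simp only [natDegree_X_sub_C, natDegree_X_add_C, Finset.sum_const, Finset.card_range]
    simp; ring
  · intro x
    simp only [eval_mul, eval_pow, eval_sub, eval_X, eval_C, eval_prod, eval_add]
    congr 1
    exact Finset.prod_congr rfl fun j _ => by ring

theorem fact_prod (b k : ℕ) :
    ((k + b).factorial : ℝ) = k.factorial * ∏ j ∈ Finset.range b, ((k:ℝ) + b - j) := by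
  induction b with
  | zero => simp
  | succ b ih =>
    rw [Finset.prod_range_succ', ← add_assoc, Nat.factorial_succ]
    push_cast
    rw [ih]
    have : ∏ j ∈ Finset.range b, ((k:ℝ) + (b + 1) - (j + 1)) =
        ∏ j ∈ Finset.range b, ((k:ℝ) + b - j) :=
      Finset.prod_congr rfl fun j _ => by ring
    rw [this]
    ring

theorem stmt4 (n q : ℕ) (hn : 2 ≤ n) (hq1 : 1 ≤ q) (hqn : q ≤ n) :
    ∃ A B C D : Polynomial ℝ,
      A.degree ≤ (2 * q - 3 : ℕ) ∧ B.degree ≤ (2 * q - 3 : ℕ) ∧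
      C.degree ≤ (2 * n - 2 * q - 1 : ℕ) ∧ D.degree ≤ (2 * n - 2 * q - 1 : ℕ) ∧
      (q = 1 → A = 0 ∧ B = 0) ∧ (q = n → C = 0 ∧ D = 0) ∧
      ∀ r p : ℕ, n + 2 ≤ r → 1 ≤ p → p ≤ r - n - 1 →
        0 < (p : ℝ) ^ (2 * q - 2) + B.eval (p : ℝ) ∧
        0 < ((r : ℝ) - p) ^ (2 * n - 2 * q) + D.eval ((r : ℝ) - p) ∧
        (1 / 2 : ℝ) * ∑ I ∈ (Finset.Icc 1 r).powersetCard (n - 1), kPure n r p q I =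
          ((r - n).choose p : ℝ) * muFn n q r p *
            (((p : ℝ) ^ (2 * q - 2) + A.eval (p : ℝ)) /
              ((p : ℝ) ^ (2 * q - 2) + B.eval (p : ℝ))) *
            ((((r : ℝ) - p) ^ (2 * n - 2 * q) + C.eval ((r : ℝ) - p)) /
              (((r : ℝ) - p) ^ (2 * n - 2 * q) + D.eval ((r : ℝ) - p))) := by
  obtain ⟨S₁, hm₁, hd₁, hS₁⟩ := sigma_poly (q - 1)
  obtain ⟨S₂, hm₂, hd₂, hS₂⟩ := sigma_poly (n - q)
  obtain ⟨T₁, hmt₁, hdt₁, hT₁⟩ := den_poly (q - 1) 0 ((q - 1 : ℕ) : ℝ)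
  obtain ⟨T₂, hmt₂, hdt₂, hT₂⟩ := den_poly (n - q) (n : ℝ) (-(q : ℝ))
  have hmS : (S₂.comp (Polynomial.X - Polynomial.C (q:ℝ))).Monic :=
    hm₂.comp (Polynomial.monic_X_sub_C _)
      (by rw [Polynomial.natDegree_X_sub_C]; exact one_ne_zero)
  have hdS : (S₂.comp (Polynomial.X - Polynomial.C (q:ℝ))).natDegree = 2 * (n - q) := by
    rw [Polynomial.natDegree_comp, hd₂, Polynomial.natDegree_X_sub_C, mul_one]
  obtain ⟨b1, b2⟩ := monic_tail _ _ hmt₁ hdt₁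
  obtain ⟨c1, c2⟩ := monic_tail _ _ hmS hdS
  obtain ⟨d1, d2⟩ := monic_tail _ _ hmt₂ hdt₂
  have eq1 : 2 * (q - 1) - 1 = 2 * q - 3 := by omega
  have eq2 : 2 * (n - q) - 1 = 2 * n - 2 * q - 1 := by omega
  have eq3 : 2 * q - 2 = 2 * (q - 1) := by omega
  have eq4 : 2 * n - 2 * q = 2 * (n - q) := by omega
  rw [eq1] at b1
  rw [eq2] at c1 d1
  have hc1 : ((S₁.comp (Polynomial.X + Polynomial.C ((q-1:ℕ):ℝ)))).Monic :=
    hm₁.comp (Polynomial.monic_X_add_C _)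
      (by rw [Polynomial.natDegree_X_add_C]; exact one_ne_zero)
  have hc2 : ((S₁.comp (Polynomial.X + Polynomial.C ((q-1:ℕ):ℝ)))).natDegree = 2 * (q - 1) := by
    rw [Polynomial.natDegree_comp, hd₁, Polynomial.natDegree_X_add_C, mul_one]
  obtain ⟨a1, a2⟩ := monic_tail _ _ hc1 hc2
  rw [eq1] at a1
  refine ⟨_, _, _, _, a1, b1, c1, d1, fun h => ⟨a2 (by omega), b2 (by omega)⟩,
    fun h => ⟨c2 (by omega), d2 (by omega)⟩, ?_⟩
  intro r p hr hp hpr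
  have heval : ∀ (k : ℕ) (S : Polynomial ℝ) (x : ℝ),
      x ^ k + (S - Polynomial.X ^ k).eval x = S.eval x := by
    intro k S x; simp
  rw [eq3, eq4]
  simp only [heval]
  obtain ⟨t, rfl⟩ : ∃ t, r = p + n + t := ⟨r - p - n, by omega⟩
  have ht : 1 ≤ t := by omega
  have hx : ((p + n + t : ℕ) : ℝ) - p = ((n + t : ℕ) : ℝ) := by push_cast; ring
  have hE1 : (S₁.comp (Polynomial.X + Polynomial.C ((q-1:ℕ):ℝ))).eval (p:ℝ) =
      2 ^ (q - 1) * (q - 1).factorial * sigmaFn (q - 1) (p + q - 1) := by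
    rw [← hS₁, Polynomial.eval_comp, show p + q - 1 = p + (q - 1) by omega]
    simp
  have hE2 : (S₂.comp (Polynomial.X - Polynomial.C (q:ℝ))).eval (((p + n + t : ℕ) : ℝ) - p) =
      2 ^ (n - q) * (n - q).factorial * sigmaFn (n - q) (p + n + t - p - q) := by
    rw [← hS₂, Polynomial.eval_comp, show p + n + t - p - q = n + t - q by omega, hx,
      Nat.cast_sub (show q ≤ n + t by omega)]
    simp
  set P₁ : ℝ := ∏ j ∈ Finset.range (q - 1), ((p:ℝ) + (q - 1 : ℕ) - j) with hP₁
  set P₂ : ℝ := ∏ j ∈ Finset.range (n - q), ((t:ℝ) + (n - q : ℕ) - j) with hP₂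
  have hF1 : ((p + q - 1).factorial : ℝ) = p.factorial * P₁ := by
    rw [show p + q - 1 = p + (q - 1) by omega, fact_prod]
  have hF2 : ((p + n + t - p - q).factorial : ℝ) = t.factorial * P₂ := by
    rw [show p + n + t - p - q = t + (n - q) by omega, fact_prod]
  have hP1 : 0 < P₁ := by
    have h : (0:ℝ) < p.factorial * P₁ := by rw [← hF1]; exact_mod_cast Nat.factorial_pos _
    exact pos_of_mul_pos_right h (by positivity)
  have hP2 : 0 < P₂ := by
    have h : (0:ℝ) < t.factorial * P₂ := by rw [← hF2]; exact_mod_cast Nat.factorial_pos _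
    exact pos_of_mul_pos_right h (by positivity)
  have hG1 : T₁.eval (p:ℝ) = (p:ℝ) ^ (q - 1) * P₁ := by rw [hT₁, sub_zero]
  have hG2 : T₂.eval (((p + n + t : ℕ) : ℝ) - p) = (t:ℝ) ^ (n - q) * P₂ := by
    rw [hT₂, hx, hP₂]
    congr 1
    · push_cast; ring
    · refine Finset.prod_congr rfl fun j _ => ?_
      push_cast [hqn]; ring
  have hp0 : (0:ℝ) < p := by exact_mod_cast hp
  have ht0 : (0:ℝ) < t := by exact_mod_cast ht
  have hsum : ∑ I ∈ (Finset.Icc 1 (p + n + t)).powersetCard (n - 1), kPure n (p + n + t) p q I =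
      ((p + t).factorial : ℝ) * ((sigmaFn (q - 1) (p + q - 1) : ℝ) *
        sigmaFn (n - q) (p + n + t - p - q)) / ((p.factorial * P₁) * (t.factorial * P₂)) := by
    have h := sum_pureNum n (p + n + t) p q hq1 hqn (by omega)
    have h' : ∑ I ∈ (Finset.Icc 1 (p + n + t)).powersetCard (n - 1), (pureNum n p q I : ℝ) =
        (sigmaFn (q - 1) (p + q - 1) : ℝ) * sigmaFn (n - q) (p + n + t - p - q) := by
      exact_mod_cast congrArg (fun z : ℤ => (z : ℝ)) h
    unfold kPure
    rw [← Finset.sum_div, ← Finset.mul_sum, h', hF1, hF2, show p + n + t - n = p + t by omega]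
  have hch : ((p + n + t - n).choose p : ℝ) =
      ((p + t).factorial : ℝ) / (p.factorial * t.factorial) := by
    rw [show p + n + t - n = p + t by omega, Nat.cast_choose ℝ (Nat.le_add_right p t),
      Nat.add_sub_cancel_left]
  have hmu : ((p + n + t : ℕ) : ℝ) - p - n = t := by push_cast; ring
  have h2n : (2:ℝ) ^ n = 2 * 2 ^ (q - 1) * 2 ^ (n - q) := by
    rw [← pow_succ', ← pow_add]; congr 1; omega
  refine ⟨by rw [hG1]; positivity, by rw [hG2]; positivity, ?_⟩
  rw [hsum, hch, hE1, hE2, hG1, hG2]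
  unfold muFn
  rw [hmu, h2n]
  have := hP1.ne'
  have := hP2.ne'
  have := hp0.ne'
  have := ht0.ne'
  field_simp
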